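/- arXiv:1803.02836 — 3 statements merged into one kernel-verified Lean document; each statement's English description precedes it below -/
import Mathlib

section
/- Let ι and κ be finite index sets, let p : κ → ℝ be nonnegative weights with Σ_k p_k = 1, and for each k ∈ κ let P^{(k)}_l : ℝ → ℝ (l ∈ ι) be differentiable functions with P^{(k)}_l(θ) > 0 at a point θ. Then F_{Σ_k p_k P^{(k)}}(θ) ≤ Σ_k p_k · F_{P^{(k)}}(θ), where Σ_k p_k P^{(k)} denotes the family l ↦ Σ_k p_k P^{(k)}_l. (This is condition 3, convexity of the invasiveness quantifier, since a convex mixture of channels Σ_k p_k Φ_k produces outcome probabilities Σ_k p_k P^{(k)}_l.) -/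
/-- Condition 3 (convexity of the invasiveness quantifier): the Fisher information
of a convex mixture `∑ k, p k • P^{(k)}` of families of outcome probabilities is at
most the corresponding mixture of Fisher informations. -/
theorem fisher_information_convex_combination
    {ι κ : Type*} [Fintype ι] [Fintype κ]
    (p : κ → ℝ) (hp : ∀ k, 0 ≤ p k) (hpsum : ∑ k, p k = 1)
    (P : κ → ι → ℝ → ℝ) (θ : ℝ)
    (hdiff : ∀ k l, DifferentiableAt ℝ (P k l) θ)
    (hpos : ∀ k l, 0 < P k l θ) :
    ∑ l, (deriv (fun t => ∑ k, p k * P k l t) θ) ^ 2 / (∑ k, p k * P k l θ) ≤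
      ∑ k, p k * ∑ l, (deriv (P k l) θ) ^ 2 / P k l θ := by
  have hderiv : ∀ l, deriv (fun t => ∑ k, p k * P k l t) θ = ∑ k, p k * deriv (P k l) θ :=
    fun l => (HasDerivAt.fun_sum fun k _ => (hdiff k l).hasDerivAt.const_mul (p k)).deriv
  simp_rw [hderiv, Finset.mul_sum]
  rw [Finset.sum_comm]
  refine Finset.sum_le_sum fun l _ => ?_
  have hden : ∀ k ∈ Finset.univ, 0 ≤ p k * P k l θ :=
    fun k _ => mul_nonneg (hp k) (hpos k l).le
  have hterm : ∀ k ∈ Finset.univ, 0 ≤ p k * (deriv (P k l) θ ^ 2 / P k l θ) :=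
    fun k _ => mul_nonneg (hp k) (div_nonneg (sq_nonneg _) (hpos k l).le)
  refine div_le_of_le_mul₀ (Finset.sum_nonneg hden) (Finset.sum_nonneg hterm) ?_
  refine Finset.sum_sq_le_sum_mul_sum_of_sq_le_mul _ hterm hden fun k _ => le_of_eq ?_
  have := (hpos k l).ne'
  field_simp
end

section
/- Let n be a finite type, let ι be a finite index set, and for each l ∈ ι let K_l be an n×n complex matrix that is incoherent, i.e., there exists a function j_l : n → n such that (K_l)_{a b} = 0 whenever a ≠ j_l(b). Then for every diagonal matrix ρ (one with ρ_{a b} = 0 for a ≠ b), the matrix Σ_{l∈ι} K_l · ρ · K_l† is diagonal. In particular, free operations (incoherent CPTP maps given by such Kraus operators) map classical states into classical states. -/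
open Matrix in

/-- Free operations map classical states to classical states: if each Kraus
operator `K l` is incoherent (each column has at most one nonzero entry), then
`∑ l, K l * ρ * (K l)ᴴ` is diagonal whenever `ρ` is diagonal. -/
theorem incoherent_kraus_preserves_diagonal
    {n : Type*} [Fintype n] [DecidableEq n] {ι : Type*} [Fintype ι]
    (K : ι → Matrix n n ℂ)
    (hK : ∀ l, ∃ j : n → n, ∀ a b, a ≠ j b → K l a b = 0)
    (ρ : Matrix n n ℂ) (hρ : ∀ a b, a ≠ b → ρ a b = 0) :
    ∀ a b, a ≠ b → (∑ l, K l * ρ * (K l)ᴴ) a b = 0 := by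
  intro a b hab
  rw [Matrix.sum_apply]
  refine Finset.sum_eq_zero fun l _ => ?_
  obtain ⟨j, hj⟩ := hK l
  rw [Matrix.mul_apply]
  refine Finset.sum_eq_zero fun d _ => ?_
  rw [Matrix.mul_apply, Finset.sum_mul]
  refine Finset.sum_eq_zero fun c _ => ?_
  rw [conjTranspose_apply]
  by_cases hcd : c = d
  · subst hcd
    by_cases ha : a = j c
    · have hb : b ≠ j c := fun hb => hab (ha.trans hb.symm)
      rw [hj b c hb, star_zero, mul_zero]
    · rw [hj a c ha, zero_mul, zero_mul]
  · rw [hρ c d hcd, mul_zero, zero_mul]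
end

section
/- Let ι be a finite index set, let S be an ι×ι real matrix that is doubly stochastic (all entries nonnegative, every row sums to 1, every column sums to 1), and let P_l : ℝ → ℝ (l ∈ ι) be differentiable functions with P_l(θ) > 0 at a point θ. Define Q_m(θ) = Σ_l S_{m l} · P_l(θ) and assume Q_m(θ) > 0 for all m. Then F_Q(θ) ≤ F_P(θ). (This is the monotonicity of the invasiveness quantifier under free post-processing: by Birkhoff's theorem a free operation acts on the diagonal outcome probabilities as a convex combination of permutations, i.e., a doubly stochastic matrix.) -/
/-- Weighted form of Sedrakyan's lemma, with nonnegative weights `w`. -/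
theorem sq_sum_mul_div_le_sum_mul_sq_div {ι : Type*} (s : Finset ι) (w a p : ι → ℝ)
    (hw : ∀ l ∈ s, 0 ≤ w l) (hp : ∀ l ∈ s, 0 < p l) :
    (∑ l ∈ s, w l * a l) ^ 2 / ∑ l ∈ s, w l * p l ≤ ∑ l ∈ s, w l * (a l ^ 2 / p l) := by
  have hwp : ∀ l ∈ s, 0 ≤ w l * p l := fun l hl ↦ mul_nonneg (hw l hl) (hp l hl).le
  have hwa : ∀ l ∈ s, 0 ≤ w l * (a l ^ 2 / p l) := fun l hl ↦
    mul_nonneg (hw l hl) (div_nonneg (sq_nonneg _) (hp l hl).le)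
  refine div_le_of_le_mul₀ (Finset.sum_nonneg hwp) (Finset.sum_nonneg hwa)
    (Finset.sum_sq_le_sum_mul_sum_of_sq_le_mul s hwa hwp fun l hl ↦ le_of_eq ?_)
  have := (hp l hl).ne'
  field_simp

/-- Monotonicity of the Fisher information (the invasiveness quantifier) under
free post-processing by a doubly stochastic matrix `S` (Birkhoff: a convex
combination of permutations). -/
theorem fisher_information_antitone_doubly_stochastic
    {ι : Type*} [Fintype ι] (S : Matrix ι ι ℝ)
    (hS_nonneg : ∀ m l, 0 ≤ S m l)
    (hS_rows : ∀ m, ∑ l, S m l = 1)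
    (hS_cols : ∀ l, ∑ m, S m l = 1)
    (P : ι → ℝ → ℝ) (θ : ℝ)
    (hdiff : ∀ l, DifferentiableAt ℝ (P l) θ)
    (hpos : ∀ l, 0 < P l θ)
    (Q : ι → ℝ → ℝ) (hQ : ∀ m t, Q m t = ∑ l, S m l * P l t)
    (hQpos : ∀ m, 0 < Q m θ) :
    ∑ m, (deriv (Q m) θ) ^ 2 / Q m θ ≤ ∑ l, (deriv (P l) θ) ^ 2 / P l θ := by
  have hderiv : ∀ m, deriv (Q m) θ = ∑ l, S m l * deriv (P l) θ := fun m ↦ by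
    rw [funext (hQ m)]
    exact (HasDerivAt.fun_sum fun l _ ↦ (hdiff l).hasDerivAt.const_mul (S m l)).deriv
  calc ∑ m, (deriv (Q m) θ) ^ 2 / Q m θ
      ≤ ∑ m, ∑ l, S m l * ((deriv (P l) θ) ^ 2 / P l θ) := by
        refine Finset.sum_le_sum fun m _ ↦ ?_
        rw [hderiv, hQ]
        exact sq_sum_mul_div_le_sum_mul_sq_div _ _ _ _ (fun l _ ↦ hS_nonneg m l)
          fun l _ ↦ hpos l
    _ = ∑ l, (deriv (P l) θ) ^ 2 / P l θ := by
        rw [Finset.sum_comm]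
        simp_rw [← Finset.sum_mul, hS_cols, one_mul]
end
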